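/- For every ε > 0 there exists a finite constant C such that for all integers h ≥ 1 and k ≥ 0, if the chain Y starts at k then P(σ̃_h < ∞ and Ỹ_{σ̃_h} = h) < C·h^{−1/2+ε}. -/

import Mathlib

open MeasureTheory ProbabilityTheory
open scoped ENNReal

/-- π(0,j) := δ_{0,j} and, for i > 0, π(i,j) := 2^{−i−j}·(i+j−1)!/((i−1)!·j!). -/
noncomputable def piGW (i j : ℕ) : ℝ :=
  if i = 0 then (if j = 0 then 1 else 0)
  else (2 : ℝ) ^ (-(i : ℝ) - (j : ℝ)) * (Nat.factorial (i + j - 1)) /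
    ((Nat.factorial (i - 1)) * (Nat.factorial j))

/-- `Y` is a Markov chain with transition probabilities `trans` started at `k`:
`P(Y_0 = k) = 1` and
`P(Y_0 = k_0, …, Y_n = k_n) = P(Y_0 = k_0) · ∏_{0 ≤ i < n} trans(k_i, k_{i+1})`. -/
def IsMarkovChainFrom {Ω : Type*} [MeasurableSpace Ω] (P : Measure Ω)
    (Y : ℕ → Ω → ℕ) (trans : ℕ → ℕ → ℝ) (k : ℕ) : Prop :=
  (∀ t, Measurable (Y t)) ∧
    ∀ (n : ℕ) (ks : ℕ → ℕ),
      P {ω | ∀ i ≤ n, Y i ω = ks i} =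
        ENNReal.ofReal ((if ks 0 = k then 1 else 0) *
          ∏ i ∈ Finset.range n, trans (ks i) (ks (i + 1)))

/-- `Ỹ_t := Y_t + Y_{t−1}`. -/
def Ytil {Ω : Type*} (Y : ℕ → Ω → ℕ) (t : ℕ) (ω : Ω) : ℕ :=
  Y t ω + Y (t - 1) ω

/-- `σ̃_h := inf{t ≥ 1 : Ỹ_t ≥ h}` (with value `∞` if there is no such `t`). -/
noncomputable def sigmaTil {Ω : Type*} (Y : ℕ → Ω → ℕ) (h : ℕ) (ω : Ω) : ℕ∞ :=
  sInf ((↑) '' {t : ℕ | 1 ≤ t ∧ h ≤ Ytil Y t ω} : Set ℕ∞)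


lemma piGW_nonneg (i j : ℕ) : 0 ≤ piGW i j := by
  unfold piGW
  split_ifs <;> positivity

lemma piGW_succ (m j : ℕ) :
    piGW (m + 1) j = ((j + m).choose m : ℝ) * (1 / 2) ^ (j + m + 1) := by
  have h2 : (2 : ℝ) ^ (-((m + 1 : ℕ) : ℝ) - (j : ℝ)) = (1 / 2) ^ (j + m + 1) := by
    rw [show -((m + 1 : ℕ) : ℝ) - (j : ℝ) = -((j + m + 1 : ℕ) : ℝ) by push_cast; ring,
      Real.rpow_neg (by norm_num), Real.rpow_natCast, one_div, inv_pow]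
  rw [piGW, if_neg (Nat.succ_ne_zero m), h2, Nat.add_choose,
    Nat.cast_div (Nat.factorial_mul_factorial_dvd_factorial_add j m) (by positivity)]
  rw [show m + 1 + j - 1 = j + m by omega, Nat.add_sub_cancel]
  push_cast
  ring

lemma hasSum_piGW_mul_pow (m : ℕ) {s : ℝ} (hs0 : 0 ≤ s) (hs1 : s ≤ 1) :
    HasSum (fun j => piGW (m + 1) j * s ^ j) ((1 / (2 - s)) ^ (m + 1)) := by
  have hr : ‖s / 2‖ < 1 := by
    rw [Real.norm_of_nonneg (by positivity)]
    linarith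
  have := (hasSum_choose_mul_geometric_of_norm_lt_one m hr).mul_left ((1 / 2 : ℝ) ^ (m + 1))
  have hpos : (2 : ℝ) - s ≠ 0 := by linarith
  convert! this using 1
  · funext j
    rw [piGW_succ, div_pow s, pow_add, pow_add, pow_add, one_div, inv_pow, inv_pow]
    ring
  · rw [show 1 - s / 2 = (2 - s) / 2 by ring, div_pow, div_pow, div_pow]
    field_simp

lemma piGW_succ_right (m j : ℕ) :
    piGW (m + 1) (j + 1) * (2 * (j + 1)) = piGW (m + 1) j * (m + 1 + j) := by
  have h := Nat.choose_mul_succ_eq (j + m) m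
  rw [show j + m + 1 - m = j + 1 by omega] at h
  have h' : ((j + m).choose m : ℝ) * (j + m + 1) = ((j + m + 1).choose m : ℝ) * (j + 1) := by
    exact_mod_cast h
  rw [piGW_succ, piGW_succ, show j + 1 + m = j + m + 1 by ring, pow_succ (1 / 2 : ℝ) (j + m + 1)]
  linear_combination (-(1 / 2 : ℝ) ^ (j + m + 1)) * h'

/-- A Gaussian bound for the lower tail of the negative binomial law. -/
lemma piGW_le_exp {h i : ℕ} (hi : 1 ≤ i) (hih : i ≤ h) (hh : 2 * i ≤ h) :
    piGW i (h - i) ≤ Real.exp (-((h : ℝ) - 2 * i) ^ 2 / (2 * h)) := by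
  obtain ⟨m, rfl⟩ := Nat.exists_eq_add_of_le' hi
  have hpos : (0 : ℝ) < h := by exact_mod_cast (by omega : 0 < h)
  set i := m + 1 with hidef
  set θ : ℝ := ((h : ℝ) - 2 * i) / h with hθ
  have hchoose : piGW i (h - i) ≤ (h.choose i : ℝ) * (1 / 2) ^ h := by
    rw [piGW_succ, show h - i + m + 1 = h by omega, show h - i + m = h - 1 by omega]
    gcongr
    have := Nat.choose_succ_succ (h - 1) m
    rw [Nat.succ_eq_add_one, Nat.succ_eq_add_one, Nat.sub_add_cancel (by omega)] at this
    rw [hidef]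
    omega
  have hcosh : (h.choose i : ℝ) * Real.exp (θ * (h - 2 * i)) ≤
      2 ^ h * Real.exp (h * (θ ^ 2 / 2)) := by
    calc (h.choose i : ℝ) * Real.exp (θ * (h - 2 * i))
        = Real.exp (-θ) ^ i * Real.exp θ ^ (h - i) * h.choose i := by
          rw [← Real.exp_nat_mul, ← Real.exp_nat_mul, ← Real.exp_add, Nat.cast_sub hih, mul_comm]
          ring_nf
      _ ≤ (Real.exp (-θ) + Real.exp θ) ^ h := by
          rw [add_pow]
          exact Finset.single_le_sum
            (f := fun l => Real.exp (-θ) ^ l * Real.exp θ ^ (h - l) * (h.choose l : ℝ))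
            (fun l _ => by positivity) (Finset.mem_range.2 (by omega))
      _ = 2 ^ h * Real.cosh θ ^ h := by
          rw [Real.cosh_eq, ← mul_pow]
          ring_nf
      _ ≤ 2 ^ h * Real.exp (h * (θ ^ 2 / 2)) := by
          rw [Real.exp_nat_mul]
          gcongr
          exact Real.cosh_le_exp_half_sq θ
  have hexp : -((h : ℝ) - 2 * i) ^ 2 / (2 * h) = h * (θ ^ 2 / 2) - θ * (h - 2 * i) := by
    rw [hθ]
    field_simp
    ring
  rw [hexp, Real.exp_sub]
  refine hchoose.trans ?_
  rw [le_div_iff₀ (Real.exp_pos _), one_div, inv_pow]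
  calc (h.choose i : ℝ) * (2 ^ h)⁻¹ * Real.exp (θ * (h - 2 * i))
      = (h.choose i : ℝ) * Real.exp (θ * (h - 2 * i)) * (2 ^ h)⁻¹ := by ring
    _ ≤ 2 ^ h * Real.exp (h * (θ ^ 2 / 2)) * (2 ^ h)⁻¹ := by gcongr
    _ = _ := by field_simp

/-- Within `l` steps past `h - i` the negative binomial weights decay by at most a
controlled exponential factor. -/
lemma exp_mul_piGW_le {h i : ℕ} (hi : 1 ≤ i) (hih : i ≤ h) {L l : ℕ} (hl : l ≤ L) {D : ℝ}
    (hiD : (h : ℝ) - 2 * i ≤ D) :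
    Real.exp (-(l * ((D + 2 * L) / h))) * piGW i (h - i) ≤ piGW i (h - i + l) := by
  obtain ⟨m, rfl⟩ := Nat.exists_eq_add_of_le' hi
  have hpos : (0 : ℝ) < h := by exact_mod_cast (by omega : 0 < h)
  induction l with
  | zero => simp
  | succ l ih =>
    have ih := ih (by omega)
    set x : ℝ := (D + 2 * L) / h with hx
    have hxh : x * h = D + 2 * L := by rw [hx]; field_simp
    have hrec := piGW_succ_right m (h - (m + 1) + l)
    have hp := piGW_nonneg (m + 1) (h - (m + 1) + l)
    have hp' := piGW_nonneg (m + 1) (h - (m + 1) + (l + 1))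
    have hlL : (l : ℝ) + 1 ≤ L := by exact_mod_cast hl
    push_cast [Nat.cast_sub hih] at hrec hiD ⊢
    have hstep : piGW (m + 1) (h - (m + 1) + l) ≤
        Real.exp x * piGW (m + 1) (h - (m + 1) + (l + 1)) := by
      have h1 : piGW (m + 1) (h - (m + 1) + l) * h ≤
          piGW (m + 1) (h - (m + 1) + (l + 1)) * (h * (x + 1)) := by
        calc _ ≤ piGW (m + 1) (h - (m + 1) + l) * (m + 1 + (h - (m + 1) + l)) := by
              gcongr
              linarith [(Nat.cast_nonneg l : (0 : ℝ) ≤ l)]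
          _ = _ := hrec.symm
          _ ≤ _ := by
              refine mul_le_mul_of_nonneg_left ?_ hp'
              linarith
      have h2 : piGW (m + 1) (h - (m + 1) + l) ≤
          piGW (m + 1) (h - (m + 1) + (l + 1)) * (x + 1) :=
        le_of_mul_le_mul_right (by linarith) hpos
      nlinarith [Real.add_one_le_exp x]
    calc Real.exp (-((l + 1) * x)) * piGW (m + 1) (h - (m + 1))
        = Real.exp (-x) * (Real.exp (-(l * x)) * piGW (m + 1) (h - (m + 1))) := by
          rw [← mul_assoc, ← Real.exp_add]
          ring_nf
      _ ≤ Real.exp (-x) * (Real.exp x * piGW (m + 1) (h - (m + 1) + (l + 1))) := by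
          exact mul_le_mul_of_nonneg_left (ih.trans hstep) (Real.exp_pos _).le
      _ = _ := by rw [← mul_assoc, ← Real.exp_add]; simp

/-- The hazard rate of the negative binomial law at `h - i`. -/
lemma mul_piGW_le_one_sub_sum {h i : ℕ} (hi : 1 ≤ i) (hih : i ≤ h) (L : ℕ) {D : ℝ}
    (hD : 0 ≤ D) (hiD : (h : ℝ) - 2 * i ≤ D) :
    L * Real.exp (-(L * ((D + 2 * L) / h))) * piGW i (h - i) ≤
      1 - ∑ j ∈ Finset.range (h - i), piGW i j := by
  have hsum : HasSum (fun j => piGW i j) 1 := by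
    obtain ⟨m, rfl⟩ := Nat.exists_eq_add_of_le' hi
    have := hasSum_piGW_mul_pow m zero_le_one le_rfl
    norm_num at this
    exact this
  have h1 := sum_le_hasSum (Finset.range (h - i + L)) (fun j _ => piGW_nonneg i j) hsum
  rw [Finset.sum_range_add] at h1
  have h2 : L * Real.exp (-(L * ((D + 2 * L) / h))) * piGW i (h - i) ≤
      ∑ l ∈ Finset.range L, piGW i (h - i + l) := by
    have := Finset.card_nsmul_le_sum (Finset.range L) (fun l => piGW i (h - i + l))
      (Real.exp (-(L * ((D + 2 * L) / h))) * piGW i (h - i)) (fun l hl => by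
        have hl := (Finset.mem_range.1 hl).le
        refine le_trans ?_ (exp_mul_piGW_le hi hih hl hiD)
        have := piGW_nonneg i (h - i)
        gcongr)
    rwa [Finset.card_range, nsmul_eq_mul, ← mul_assoc] at this
  linarith

/-- Expected decrease of the potential `1 - (1 - 1 / h) ^ i` along the chain. -/
lemma sum_piGW_mul_one_sub_pow_le {h i : ℕ} (hh : 1 ≤ h) (hi : 1 ≤ i) (n : ℕ) :
    ∑ j ∈ Finset.range n, piGW i j * (1 - (1 - 1 / (h : ℝ)) ^ j) ≤
      1 - ((h : ℝ) / (h + 1)) ^ i := by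
  obtain ⟨m, rfl⟩ := Nat.exists_eq_add_of_le' hi
  have hpos : (1 : ℝ) ≤ h := by exact_mod_cast hh
  have hs0 : 0 ≤ 1 - 1 / (h : ℝ) := by
    rw [sub_nonneg, div_le_one (by linarith)]
    exact hpos
  have hs1 : 1 - 1 / (h : ℝ) ≤ 1 := by
    have : 0 ≤ 1 / (h : ℝ) := by positivity
    linarith
  have h1 := (hasSum_piGW_mul_pow m zero_le_one le_rfl).sub (hasSum_piGW_mul_pow m hs0 hs1)
  have h2 := sum_le_hasSum (Finset.range n) (fun j _ => by
    rw [← mul_sub, one_pow]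
    exact mul_nonneg (piGW_nonneg _ _) (sub_nonneg.2 (pow_le_one₀ hs0 hs1))) h1
  have h3 : (1 : ℝ) / (2 - (1 - 1 / h)) = h / (h + 1) := by
    rw [show 2 - (1 - 1 / (h : ℝ)) = (h + 1) / h by field_simp; ring, one_div_div]
  simp only [one_pow, ← mul_sub, h3] at h2
  norm_num at h2
  simpa using h2

lemma inv_sq_le_pow_sub_pow {h i : ℕ} (hi : 1 ≤ i) (hih : i ≤ h) :
    1 / (6 * (h : ℝ) ^ 2) ≤ ((h : ℝ) / (h + 1)) ^ i - (1 - 1 / (h : ℝ)) ^ i := by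
  obtain ⟨m, rfl⟩ := Nat.exists_eq_add_of_le' hi
  have hpos : (1 : ℝ) ≤ h := by exact_mod_cast hi.trans hih
  have hb0 : 0 ≤ 1 - 1 / (h : ℝ) := by
    rw [sub_nonneg, div_le_one (by linarith)]
    exact hpos
  set a : ℝ := (h : ℝ) / (h + 1) with ha
  set b : ℝ := 1 - 1 / (h : ℝ) with hb
  have hab : a - b = 1 / (h * (h + 1)) := by
    rw [ha, hb]
    field_simp
    ring
  have hba : b ≤ a := by
    have : 0 ≤ a - b := by rw [hab]; positivity
    linarith
  have ha0 : 0 ≤ a := hb0.trans hba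
  have h1 : a ^ m * (a - b) ≤ a ^ (m + 1) - b ^ (m + 1) := by
    have : b ^ m * b ≤ a ^ m * b := by gcongr
    rw [pow_succ, pow_succ]
    linarith
  have h2 : 1 / 3 ≤ a ^ m := by
    have h3 : Real.exp (-(1 / h)) ≤ a := by
      rw [ha, Real.exp_neg, inv_le_comm₀ (Real.exp_pos _) (by positivity), inv_div]
      calc ((h : ℝ) + 1) / h = 1 / h + 1 := by field_simp; ring
        _ ≤ _ := Real.add_one_le_exp _
    calc (1 : ℝ) / 3 ≤ Real.exp (-1) := by
          rw [Real.exp_neg, one_div]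
          gcongr
          linarith [Real.exp_one_lt_d9]
      _ ≤ Real.exp (m * (-(1 / h))) := by
          gcongr
          have : (m : ℝ) ≤ h := by exact_mod_cast (by omega : m ≤ h)
          have : (m : ℝ) * (1 / h) ≤ 1 := by
            rw [mul_one_div, div_le_one (by linarith)]
            exact this
          linarith
      _ = Real.exp (-(1 / h)) ^ m := Real.exp_nat_mul _ _
      _ ≤ a ^ m := by gcongr
  refine le_trans ?_ h1
  rw [hab]
  calc 1 / (6 * (h : ℝ) ^ 2) = 1 / 3 * (1 / (h * (h + h))) := by field_simp; norm_num
    _ ≤ _ := by gcongr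

/-- A potential which is superharmonic for the chain stopped when the sum of two successive
values reaches `h`, with reward one if it equals `h`. -/
lemma reward_add_sum_piGW_le {h : ℕ} (hh : 1 ≤ h) {δ M : ℝ} (hδ : 0 ≤ δ) (hM : 0 ≤ M)
    (hp : ∀ i, 1 ≤ i → i ≤ h →
      piGW i (h - i) ≤ δ * (1 - ∑ j ∈ Finset.range (h - i), piGW i j) ∨
      piGW i (h - i) ≤ M * (1 / (6 * (h : ℝ) ^ 2))) (i : ℕ) :
    (if i ≤ h then piGW i (h - i) else 0) +
      ∑ j ∈ Finset.range (h - i), piGW i j * (δ + M * (1 - (1 - 1 / (h : ℝ)) ^ j)) ≤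
      δ + M * (1 - (1 - 1 / (h : ℝ)) ^ i) := by
  have hpos : (1 : ℝ) ≤ h := by exact_mod_cast hh
  have hb0 : 0 ≤ 1 - 1 / (h : ℝ) := by
    rw [sub_nonneg, div_le_one (by linarith)]
    exact hpos
  have hb1 : 1 - 1 / (h : ℝ) ≤ 1 := by
    have : 0 ≤ 1 / (h : ℝ) := by positivity
    linarith
  have hV : 0 ≤ M * (1 - (1 - 1 / (h : ℝ)) ^ i) :=
    mul_nonneg hM (sub_nonneg.2 (pow_le_one₀ hb0 hb1))
  rcases Nat.eq_zero_or_pos i with rfl | hi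
  · have h1 : ∀ j, piGW 0 j = if j = 0 then 1 else 0 := fun j => by simp [piGW]
    simp [h1, show h ≠ 0 by omega, show 0 < h by omega]
  by_cases hih : i ≤ h
  · have h1 : ∑ j ∈ Finset.range (h - i), piGW i j * (δ + M * (1 - (1 - 1 / (h : ℝ)) ^ j)) =
        δ * ∑ j ∈ Finset.range (h - i), piGW i j +
        M * ∑ j ∈ Finset.range (h - i), piGW i j * (1 - (1 - 1 / (h : ℝ)) ^ j) := by
      rw [Finset.mul_sum, Finset.mul_sum, ← Finset.sum_add_distrib]
      exact Finset.sum_congr rfl fun j _ => by ring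
    have h2 := mul_le_mul_of_nonneg_left
      (sum_piGW_mul_one_sub_pow_le hh hi (h - i)) hM
    have h3 := mul_le_mul_of_nonneg_left (inv_sq_le_pow_sub_pow hi hih) hM
    have h4 : ∑ j ∈ Finset.range (h - i), piGW i j ≤ 1 := by
      obtain ⟨m, rfl⟩ := Nat.exists_eq_add_of_le' hi
      have := sum_le_hasSum (Finset.range (h - (m + 1))) (fun j _ => by
        rw [one_pow, mul_one]
        exact piGW_nonneg _ j) (hasSum_piGW_mul_pow m zero_le_one le_rfl)
      norm_num at this
      exact this
    have h5 := mul_le_mul_of_nonneg_left h4 hδ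
    have h6 : 0 ≤ M * (1 / (6 * (h : ℝ) ^ 2)) := by positivity
    rw [if_pos hih, h1]
    rcases hp i hi hih with h | h <;> linarith
  · rw [if_neg hih, show h - i = 0 by omega]
    simp only [Finset.range_zero, Finset.sum_empty]
    linarith

lemma IsMarkovChainFrom.measure_inter_eq_mul {Ω : Type*} [MeasurableSpace Ω] {P : Measure Ω}
    {Y : ℕ → Ω → ℕ} {trans : ℕ → ℕ → ℝ} {k : ℕ} (hY : IsMarkovChainFrom P Y trans k)
    (htrans : ∀ i j, 0 ≤ trans i j) (t i j : ℕ) (A : Set (Fin (t + 1) → ℕ)) :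
    P {ω | ((fun s : Fin (t + 1) => Y s ω) ∈ A ∧ Y t ω = i) ∧ Y (t + 1) ω = j} =
      P {ω | (fun s : Fin (t + 1) => Y s ω) ∈ A ∧ Y t ω = i} *
        ENNReal.ofReal (trans i j) := by
  have hm := hY.1
  set X : Ω → Fin (t + 1) → ℕ := fun ω s => Y s ω with hXdef
  have hX : Measurable X := measurable_pi_lambda _ fun s => hm s
  have hA : MeasurableSet A := A.to_countable.measurableSet
  have key : (P.restrict ({ω | Y t ω = i} ∩ {ω | Y (t + 1) ω = j})).map X =
      ENNReal.ofReal (trans i j) • (P.restrict {ω | Y t ω = i}).map X := by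
    refine Measure.ext_of_singleton fun x => ?_
    have hx : MeasurableSet ({x} : Set (Fin (t + 1) → ℕ)) := measurableSet_singleton x
    rw [Measure.smul_apply, Measure.map_apply hX hx, Measure.map_apply hX hx,
      Measure.restrict_apply (hX hx), Measure.restrict_apply (hX hx), smul_eq_mul]
    by_cases hxi : x (Fin.last t) = i
    · set ks : ℕ → ℕ := fun n => if hn : n < t + 1 then x ⟨n, hn⟩ else j with hks
      have hks1 : ∀ n (hn : n < t + 1), ks n = x ⟨n, hn⟩ := fun n hn => dif_pos hn
      have hkst : ks t = i := by rw [hks1 t (by omega), ← hxi]; rfl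
      have hksj : ks (t + 1) = j := by simp [hks]
      have hXx : ∀ ω, X ω = x ↔ ∀ n ≤ t, Y n ω = ks n := fun ω => by
        rw [funext_iff]
        constructor
        · intro h n hn
          rw [hks1 n (by omega), ← h]
        · rintro h ⟨n, hn⟩
          rw [← hks1 n hn, ← h n (by omega)]
      have e1 : X ⁻¹' {x} ∩ {ω | Y t ω = i} = {ω | ∀ n ≤ t, Y n ω = ks n} := by
        ext ω
        simp only [Set.mem_inter_iff, Set.mem_preimage, Set.mem_singleton_iff, Set.mem_ofPred_eq,
          hXx]
        exact ⟨fun h => h.1, fun h => ⟨h, by rw [h t le_rfl, hkst]⟩⟩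
      have e2 : X ⁻¹' {x} ∩ ({ω | Y t ω = i} ∩ {ω | Y (t + 1) ω = j}) =
          {ω | ∀ n ≤ t + 1, Y n ω = ks n} := by
        rw [← Set.inter_assoc, e1]
        ext ω
        simp only [Set.mem_inter_iff, Set.mem_ofPred_eq, Nat.le_succ_iff]
        constructor
        · rintro ⟨h, h'⟩ n (hn | rfl)
          · exact h n hn
          · rw [h', hksj]
        · exact fun h => ⟨fun n hn => h n (Or.inl hn), by rw [h _ (Or.inr rfl), hksj]⟩
      rw [e1, e2, hY.2, hY.2, Finset.prod_range_succ, ← mul_assoc, hkst, hksj,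
        ENNReal.ofReal_mul' (htrans i j), mul_comm]
    · have e : X ⁻¹' {x} ∩ {ω | Y t ω = i} = ∅ := by
        rw [Set.eq_empty_iff_forall_notMem]
        rintro ω ⟨h1, h2⟩
        rw [Set.mem_preimage, Set.mem_singleton_iff] at h1
        exact hxi (h1 ▸ h2)
      rw [← Set.inter_assoc, e]
      simp
  have := congrArg (fun μ => μ A) key
  simp only [Measure.smul_apply, smul_eq_mul] at this
  rw [Measure.map_apply hX hA, Measure.map_apply hX hA, Measure.restrict_apply (hX hA),
    Measure.restrict_apply (hX hA), ← Set.inter_assoc] at this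
  rw [mul_comm]
  exact this

/-- The event that `Ỹ` has stayed below `h` up to time `t` and `Y` is at `i` at time `t`. -/
def belowAt {Ω : Type*} (Y : ℕ → Ω → ℕ) (h t i : ℕ) : Set Ω :=
  {ω | (∀ s, 1 ≤ s → s ≤ t → Ytil Y s ω < h) ∧ Y t ω = i}

lemma IsMarkovChainFrom.measure_belowAt_inter {Ω : Type*} [MeasurableSpace Ω] {P : Measure Ω}
    {Y : ℕ → Ω → ℕ} {trans : ℕ → ℕ → ℝ} {k : ℕ} (hY : IsMarkovChainFrom P Y trans k)
    (htrans : ∀ i j, 0 ≤ trans i j) (h t i j : ℕ) :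
    P (belowAt Y h t i ∩ {ω | Y (t + 1) ω = j}) =
      P (belowAt Y h t i) * ENNReal.ofReal (trans i j) := by
  have e : belowAt Y h t i = {ω | (fun s : Fin (t + 1) => Y s ω) ∈
      {x : Fin (t + 1) → ℕ | ∀ s, (hs : s ≤ t) → 1 ≤ s →
        x ⟨s, by omega⟩ + x ⟨s - 1, by omega⟩ < h} ∧ Y t ω = i} := by
    ext ω
    simp only [belowAt, Ytil, Set.mem_ofPred_eq]
    exact and_congr_left fun _ => forall_congr' fun s => forall_comm
  rw [e]
  exact hY.measure_inter_eq_mul htrans t i j _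

/-- Optional stopping: a superharmonic potential dominates the probability of first reaching
level `h` exactly. -/
lemma IsMarkovChainFrom.measure_sigmaTil_le {Ω : Type*} [MeasurableSpace Ω] {P : Measure Ω}
    {Y : ℕ → Ω → ℕ} {trans : ℕ → ℕ → ℝ} {k : ℕ} (hY : IsMarkovChainFrom P Y trans k)
    (htrans : ∀ i j, 0 ≤ trans i j) (h : ℕ) (V : ℕ → ℝ≥0∞)
    (hV : ∀ i, ∑' j, ENNReal.ofReal (trans i j) *
      (if i + j = h then 1 else if i + j < h then V j else 0) ≤ V i) :
    P {ω | ∃ t : ℕ, sigmaTil Y h ω = (t : ℕ∞) ∧ Ytil Y t ω = h} ≤ V k := by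
  set S : ℕ → Set Ω := fun t => ⋃ i, ⋃ j, {ω | i + j = h ∧
    ω ∈ belowAt Y h t i ∩ {ω | Y (t + 1) ω = j}} with hS
  have hsub : {ω | ∃ t : ℕ, sigmaTil Y h ω = (t : ℕ∞) ∧ Ytil Y t ω = h} ⊆ ⋃ t, S t := by
    rintro ω ⟨t, ht, hth⟩
    have hne : ((↑) '' {t : ℕ | 1 ≤ t ∧ h ≤ Ytil Y t ω} : Set ℕ∞).Nonempty := by
      by_contra hcon
      rw [Set.not_nonempty_iff_eq_empty] at hcon
      rw [sigmaTil, hcon, sInf_empty] at ht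
      exact ENat.natCast_ne_top t ht.symm
    have hmem := csInf_mem hne
    rw [← sigmaTil, ht] at hmem
    obtain ⟨t', ⟨ht1, -⟩, htt⟩ := hmem
    have htt : t' = t := by exact_mod_cast htt
    subst htt
    obtain ⟨r, rfl⟩ := Nat.exists_eq_add_of_le' ht1
    simp only [hS, Set.mem_iUnion]
    refine ⟨r, Y r ω, Y (r + 1) ω, ?_, ⟨?_, rfl⟩, rfl⟩
    · rw [← hth, Ytil, Nat.add_sub_cancel, add_comm]
    · intro s hs1 hs
      by_contra! hcon
      have : sigmaTil Y h ω ≤ (s : ℕ∞) := sInf_le ⟨s, ⟨hs1, hcon⟩, rfl⟩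
      rw [ht] at this
      have : r + 1 ≤ s := by exact_mod_cast this
      omega
  set Φ : ℕ → ℝ≥0∞ := fun t => ∑' i, P (belowAt Y h t i) * V i with hΦ
  have hstep : ∀ t, P (S t) + Φ (t + 1) ≤ Φ t := by
    intro t
    have h1 : P (S t) ≤ ∑' i, ∑' j, P (belowAt Y h t i ∩ {ω | Y (t + 1) ω = j}) *
        (if i + j = h then 1 else 0) := by
      refine (measure_iUnion_le _).trans (ENNReal.tsum_le_tsum fun i => ?_)
      refine (measure_iUnion_le _).trans (ENNReal.tsum_le_tsum fun j => ?_)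
      split_ifs with hij
      · simp only [hij, true_and, mul_one]
        exact le_rfl
      · simp [hij]
    have h2 : Φ (t + 1) ≤ ∑' i, ∑' j, P (belowAt Y h t i ∩ {ω | Y (t + 1) ω = j}) *
        (if i + j < h then V j else 0) := by
      rw [ENNReal.tsum_comm]
      refine ENNReal.tsum_le_tsum fun j => ?_
      have : belowAt Y h (t + 1) j ⊆
          ⋃ i, {ω | i + j < h ∧ ω ∈ belowAt Y h t i ∩ {ω | Y (t + 1) ω = j}} := by
        rintro ω ⟨hω, hj⟩
        refine Set.mem_iUnion.2 ⟨Y t ω, ?_, ⟨fun s hs hst => hω s hs (by omega), rfl⟩, hj⟩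
        have := hω (t + 1) (by omega) le_rfl
        rw [Ytil, hj, Nat.add_sub_cancel] at this
        omega
      refine (mul_le_mul_left ((measure_mono this).trans (measure_iUnion_le _)) (V j)).trans ?_
      rw [← ENNReal.tsum_mul_right]
      refine ENNReal.tsum_le_tsum fun i => ?_
      split_ifs with hij
      · simp only [hij, true_and]
        exact le_rfl
      · simp [hij]
    refine (add_le_add h1 h2).trans ?_
    rw [← ENNReal.tsum_add]
    refine ENNReal.tsum_le_tsum fun i => ?_
    rw [← ENNReal.tsum_add]
    refine le_trans (le_of_eq ?_) (mul_le_mul_right (hV i) (P (belowAt Y h t i)))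
    rw [← ENNReal.tsum_mul_left]
    refine tsum_congr fun j => ?_
    rw [hY.measure_belowAt_inter htrans, ← mul_assoc, ← mul_add]
    congr 1
    split_ifs with h3 h4 <;> first | omega | simp
  have hzero : Φ 0 ≤ V k := by
    have h0 : ∀ i, P (belowAt Y h 0 i) = if i = k then 1 else 0 := fun i => by
      have e : belowAt Y h 0 i = {ω | ∀ n ≤ 0, Y n ω = (fun _ => i) n} := by
        ext ω
        simp only [belowAt, Set.mem_ofPred_eq, Nat.le_zero]
        constructor
        · rintro ⟨-, hi⟩ n rfl
          exact hi
        · exact fun hi => ⟨fun s hs hs' => by omega, hi 0 rfl⟩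
      rw [e, hY.2]
      split_ifs <;> simp
    simp [hΦ, h0]
  have hsum : ∀ n, ∑ t ∈ Finset.range n, P (S t) + Φ n ≤ V k := by
    intro n
    induction n with
    | zero => simpa using hzero
    | succ n ih =>
      rw [Finset.sum_range_succ, add_assoc]
      exact (add_le_add_right (hstep n) _).trans ih
  calc _ ≤ P (⋃ t, S t) := measure_mono hsub
    _ ≤ ∑' t, P (S t) := measure_iUnion_le _
    _ ≤ V k := ENNReal.tsum_le_of_sum_range_le fun n => le_self_add.trans (hsum n)

lemma IsMarkovChainFrom.measure_sigmaTil_le_add {Ω : Type*} [MeasurableSpace Ω] {P : Measure Ω}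
    {Y : ℕ → Ω → ℕ} {k : ℕ} (hY : IsMarkovChainFrom P Y piGW k) {h : ℕ} (hh : 1 ≤ h)
    {δ M : ℝ} (hδ : 0 ≤ δ) (hM : 0 ≤ M)
    (hp : ∀ i, 1 ≤ i → i ≤ h →
      piGW i (h - i) ≤ δ * (1 - ∑ j ∈ Finset.range (h - i), piGW i j) ∨
      piGW i (h - i) ≤ M * (1 / (6 * (h : ℝ) ^ 2))) :
    P {ω | ∃ t : ℕ, sigmaTil Y h ω = (t : ℕ∞) ∧ Ytil Y t ω = h} ≤ ENNReal.ofReal (δ + M) := by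
  have hpos : (1 : ℝ) ≤ h := by exact_mod_cast hh
  have hb0 : 0 ≤ 1 - 1 / (h : ℝ) := by
    rw [sub_nonneg, div_le_one (by linarith)]
    exact hpos
  have hb1 : 1 - 1 / (h : ℝ) ≤ 1 := by
    have : 0 ≤ 1 / (h : ℝ) := by positivity
    linarith
  set V : ℕ → ℝ := fun i => δ + M * (1 - (1 - 1 / (h : ℝ)) ^ i) with hVdef
  have hV0 : ∀ i, 0 ≤ V i := fun i =>
    add_nonneg hδ (mul_nonneg hM (sub_nonneg.2 (pow_le_one₀ hb0 hb1)))
  refine (hY.measure_sigmaTil_le piGW_nonneg h (fun i => ENNReal.ofReal (V i)) fun i => ?_).trans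
    (ENNReal.ofReal_le_ofReal ?_)
  · refine le_trans (le_of_eq ?_)
      (ENNReal.ofReal_le_ofReal (reward_add_sum_piGW_le hh hδ hM hp i))
    rw [tsum_eq_sum (s := Finset.range (h - i + 1)) fun j hj => by
      rw [Finset.mem_range] at hj
      rw [if_neg (by omega), if_neg (by omega), mul_zero],
      Finset.sum_range_succ, add_comm,
      ENNReal.ofReal_add (by split_ifs <;> simp [piGW_nonneg])
        (Finset.sum_nonneg fun j _ => mul_nonneg (piGW_nonneg i j) (hV0 j)),
      ENNReal.ofReal_sum_of_nonneg fun j _ => mul_nonneg (piGW_nonneg i j) (hV0 j)]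
    congr 1
    · by_cases hih : i ≤ h
      · simp [hih]
      · rw [if_neg (by omega), if_neg (by omega), if_neg hih]
        simp
    · refine Finset.sum_congr rfl fun j hj => ?_
      rw [Finset.mem_range] at hj
      rw [if_neg (by omega), if_pos (by omega), ENNReal.ofReal_mul (piGW_nonneg i j)]
  · have : 0 ≤ M * (1 - 1 / (h : ℝ)) ^ k := mul_nonneg hM (pow_nonneg hb0 k)
    simp only [hVdef]
    linarith

lemma piGW_dichotomy {ε : ℝ} (hε : 0 < ε) (hε' : ε ≤ 1 / 2) {h i : ℕ} (hi : 1 ≤ i)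
    (hih : i ≤ h) :
    piGW i (h - i) ≤ (Real.exp 10 * (h : ℝ) ^ (-(1 : ℝ) / 2 + ε)) *
        (1 - ∑ j ∈ Finset.range (h - i), piGW i j) ∨
      piGW i (h - i) ≤ Real.exp (-((h : ℝ) ^ (2 * ε) / 2)) := by
  have hh : (1 : ℝ) ≤ h := by exact_mod_cast hi.trans hih
  have hpos : (0 : ℝ) < h := by linarith
  have hp := piGW_nonneg i (h - i)
  set D : ℝ := (h : ℝ) ^ (1 / 2 + ε) with hD
  have hD0 : 0 < D := Real.rpow_pos_of_pos hpos _
  rcases le_or_gt ((h : ℝ) - 2 * i) D with hiD | hiD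
  · left
    set u : ℝ := (h : ℝ) ^ (1 / 2 - ε) with hu
    have hu1 : 1 ≤ u := Real.one_le_rpow hh (by linarith)
    have huD : u * D = h := by
      rw [hu, hD, ← Real.rpow_add hpos]
      norm_num
    have huu : u * u ≤ h := by
      rw [← huD]
      have : u ≤ D := Real.rpow_le_rpow_of_exponent_le hh (by linarith)
      gcongr
    have huv : u * (h : ℝ) ^ (-(1 : ℝ) / 2 + ε) = 1 := by
      rw [hu, ← Real.rpow_add hpos]
      ring_nf
      exact Real.rpow_zero _
    set L := ⌈u⌉₊ with hL
    have hL1 : u ≤ L := Nat.le_ceil u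
    have hL2 : (L : ℝ) ≤ 2 * u := by linarith [Nat.ceil_lt_add_one (show 0 ≤ u by linarith)]
    have hexp : (L : ℝ) * ((D + 2 * L) / h) ≤ 10 := by
      rw [← mul_div_assoc, div_le_iff₀ hpos]
      calc (L : ℝ) * (D + 2 * L) ≤ 2 * u * (D + 2 * (2 * u)) := by gcongr
        _ = 2 * (u * D) + 8 * (u * u) := by ring
        _ ≤ 10 * h := by linarith
    have key := mul_piGW_le_one_sub_sum hi hih L hD0.le hiD
    have hlow : u * Real.exp (-10) * piGW i (h - i) ≤
        1 - ∑ j ∈ Finset.range (h - i), piGW i j := by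
      refine le_trans ?_ key
      gcongr
    calc piGW i (h - i)
        = (Real.exp 10 * Real.exp (-10)) * (u * (h : ℝ) ^ (-(1 : ℝ) / 2 + ε)) *
            piGW i (h - i) := by
          rw [huv, ← Real.exp_add]
          simp
      _ = (Real.exp 10 * (h : ℝ) ^ (-(1 : ℝ) / 2 + ε)) *
            (u * Real.exp (-10) * piGW i (h - i)) := by ring
      _ ≤ _ := by gcongr
  · right
    have h2 : 2 * i ≤ h := by
      have : (2 * i : ℝ) ≤ h := by linarith
      exact_mod_cast this
    refine (piGW_le_exp hi hih h2).trans (Real.exp_le_exp.2 ?_)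
    have hDD : D ^ 2 = (h : ℝ) ^ (2 * ε) * h := by
      rw [hD, ← Real.rpow_natCast, ← Real.rpow_mul hpos.le]
      nth_rewrite 3 [← Real.rpow_one (h : ℝ)]
      rw [← Real.rpow_add hpos]
      congr 1
      push_cast
      ring
    have h3 : D ^ 2 ≤ ((h : ℝ) - 2 * i) ^ 2 := by gcongr
    rw [hDD] at h3
    rw [neg_div, neg_le_neg_iff, le_div_iff₀ (by linarith)]
    linarith

lemma exists_sq_mul_exp_le {ε : ℝ} (hε : 0 < ε) :
    ∃ C : ℝ, 0 ≤ C ∧ ∀ x : ℝ, 1 ≤ x →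
      x ^ 2 * Real.exp (-(x ^ (2 * ε) / 2)) ≤ C * x ^ (-(1 : ℝ) / 2 + ε) := by
  obtain ⟨n, hn⟩ := exists_nat_ge (5 / 2 / (2 * ε))
  rw [div_le_iff₀ (by positivity)] at hn
  refine ⟨n.factorial * 2 ^ n, by positivity, fun x hx => ?_⟩
  have hpos : 0 < x := by linarith
  have h1 := Real.pow_div_factorial_le_exp (x ^ (2 * ε) / 2) (by positivity) n
  have h2 : Real.exp (-(x ^ (2 * ε) / 2)) ≤ n.factorial * 2 ^ n * x ^ (-(n * (2 * ε))) := by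
    rw [Real.exp_neg, Real.rpow_neg hpos.le, mul_comm (n : ℝ), Real.rpow_mul hpos.le _ (n : ℝ),
      Real.rpow_natCast]
    refine (inv_anti₀ (by positivity) h1).trans (le_of_eq ?_)
    rw [inv_div, div_pow]
    field_simp
  calc x ^ 2 * Real.exp (-(x ^ (2 * ε) / 2))
      ≤ x ^ 2 * (n.factorial * 2 ^ n * x ^ (-(n * (2 * ε)))) := by gcongr
    _ = n.factorial * 2 ^ n * x ^ (2 + -(n * (2 * ε))) := by
        rw [Real.rpow_add hpos, Real.rpow_two]
        ring
    _ ≤ _ := by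
        have : x ^ (2 + -(n * (2 * ε))) ≤ x ^ (-(1 : ℝ) / 2 + ε) :=
          Real.rpow_le_rpow_of_exponent_le hx (by linarith)
        gcongr

/-- For every ε > 0 there exists a finite constant C such that for all integers
h ≥ 1 and k ≥ 0, if the chain Y starts at k then
P(σ̃_h < ∞ and Ỹ_{σ̃_h} = h) < C·h^{−1/2+ε}. -/
theorem stmt_7 :
    ∀ ε : ℝ, 0 < ε → ∃ C : ℝ,
      ∀ (h k : ℕ), 1 ≤ h →
        ∀ (Ω : Type) (_ : MeasurableSpace Ω) (P : Measure Ω) (Y : ℕ → Ω → ℕ),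
          IsProbabilityMeasure P → IsMarkovChainFrom P Y piGW k →
          P {ω | ∃ t : ℕ, sigmaTil Y h ω = (t : ℕ∞) ∧ Ytil Y t ω = h} <
            ENNReal.ofReal (C * (h : ℝ) ^ (-(1 : ℝ) / 2 + ε)) := by
  intro ε₀ hε₀
  set ε := min ε₀ (1 / 2) with hεdef
  have hε : 0 < ε := lt_min hε₀ (by norm_num)
  obtain ⟨C, hC0, hC⟩ := exists_sq_mul_exp_le hε
  refine ⟨Real.exp 10 + 6 * C + 1, fun h k hh Ω _ P Y _ hY => ?_⟩
  have hh' : (1 : ℝ) ≤ h := by exact_mod_cast hh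
  have hpos : (0 : ℝ) < h := by linarith
  have hCh := hC h hh'
  set v : ℝ := (h : ℝ) ^ (-(1 : ℝ) / 2 + ε) with hv
  have hv0 : 0 < v := Real.rpow_pos_of_pos hpos _
  have hvv : v ≤ (h : ℝ) ^ (-(1 : ℝ) / 2 + ε₀) :=
    Real.rpow_le_rpow_of_exponent_le hh' (by linarith [min_le_left ε₀ (1 / 2)])
  have hbound := hY.measure_sigmaTil_le_add hh (δ := Real.exp 10 * v)
    (M := 6 * ((h : ℝ) ^ 2 * Real.exp (-((h : ℝ) ^ (2 * ε) / 2)))) (by positivity)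
    (by positivity) fun i hi hih => by
      refine (piGW_dichotomy hε (min_le_right _ _) hi hih).imp id fun H => H.trans (le_of_eq ?_)
      field_simp
  refine hbound.trans_lt ((ENNReal.ofReal_lt_ofReal_iff (by positivity)).2 ?_)
  calc _ ≤ Real.exp 10 * v + 6 * (C * v) := by linarith
    _ < (Real.exp 10 + 6 * C + 1) * v := by linarith
    _ ≤ _ := by gcongr
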